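/- arXiv:1507.05324 — 5 statements merged into one kernel-verified Lean document; each statement's English description precedes it below -/
import Mathlib

section
/- Let 1 ≤ k and 0 ≤ m be integers and let u_1, …, u_{m+k} ∈ ℝ^m be vectors such that (if m > 0) u_1, …, u_m are linearly independent, i.e. the m×m determinant V_0 := det(u_{i,j})_{1≤i,j≤m} is nonzero. Let w_1, …, w_{m+k} ∈ D^k([a,b]) be functions such that V_n(ξ) := W(w_1,…,w_{m+n}; u_1,…,u_{m+n})(ξ,…,ξ) (with n repeated points ξ) is nonzero for all ξ ∈ [a,b] and all n = 1, …, k. Then for all points x_1, …, x_{k+1} ∈ [a,b] that are not all identical, all vectors p, q ∈ ℝ^m, and all functions f, g ∈ D^k([a,b]), there exists an intermediate point ξ ∈ ]min_i x_i, max_i x_i[ such that W(w_1,…,w_{m+k},f; u_1,…,u_{m+k},p)(ξ,…,ξ) · W(w_1,…,w_{m+k},g; u_1,…,u_{m+k},q)(x_1,…,x_{k+1}) = W(w_1,…,w_{m+k},g; u_1,…,u_{m+k},q)(ξ,…,ξ) · W(w_1,…,w_{m+k},f; u_1,…,u_{m+k},p)(x_1,…,x_{k+1}). -/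
/-- The derivative order attached to column `j`: the number of earlier indices carrying
the same point value as `x j`. -/
noncomputable def multBefore {k : ℕ} (x : Fin k → ℝ) (j : Fin k) : ℕ :=
  Nat.card {i : Fin k // i < j ∧ x i = x j}

/-- Generalized Wronskian determinant of the system `w` at the points `x`
(repetitions of a point produce successive derivative columns). -/
noncomputable def genW {k : ℕ} (w : Fin k → ℝ → ℝ) (x : Fin k → ℝ) : ℝ :=
  Matrix.det (Matrix.of fun i j : Fin k => iteratedDeriv (multBefore x j) (w i) (x j))

/-- Generalized Wronskian determinant with a vector part: the first `m` columns are the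
coordinates of the vectors `u i`, the remaining `k` columns are derivative columns at `x`. -/
noncomputable def genWu (m k : ℕ) (w : Fin (m + k) → ℝ → ℝ) (u : Fin (m + k) → Fin m → ℝ)
    (x : Fin k → ℝ) : ℝ :=
  Matrix.det (Matrix.of fun i j : Fin (m + k) =>
    Fin.addCases (fun jm : Fin m => u i jm)
      (fun jk : Fin k => iteratedDeriv (multBefore x jk) (w i) (x jk)) j)

/-- `f ∈ D^k([a,b])`: `f` is `k-1` times continuously differentiable on `[a,b]` and
`k` times differentiable on `]a,b[`. -/
def MemDk (k : ℕ) (a b : ℝ) (f : ℝ → ℝ) : Prop :=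
  (∀ j < k - 1, ∀ x ∈ Set.Icc a b, DifferentiableAt ℝ (iteratedDeriv j f) x) ∧
  (∀ j ≤ k - 1, ContinuousOn (iteratedDeriv j f) (Set.Icc a b)) ∧
  (∀ x ∈ Set.Ioo a b, DifferentiableAt ℝ (iteratedDeriv (k - 1) f) x)

/-- `f` vanishes `K` times in `[a,b]`. -/
def VanishesTimes (K : ℕ) (a b : ℝ) (f : ℝ → ℝ) : Prop :=
  ∃ (n : ℕ) (x : Fin (n + 1) → ℝ) (κ : Fin (n + 1) → ℕ),
    StrictMono x ∧ (∀ i, x i ∈ Set.Icc a b) ∧ x 0 < b ∧ a < x (Fin.last n) ∧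
    (∀ i, 1 ≤ κ i) ∧ (∑ i, κ i) = K ∧
    ∀ i, ∀ j < κ i, iteratedDeriv j f (x i) = 0

/-- If any two zeros of `G n` enclose a zero of `G (n + 1)`, then `r + 1` zeros of the chain, counted
with multiplicity, force a zero of `G r`. -/
theorem exists_zero_of_rolle_chain (a b : ℝ) (r : ℕ) (G : ℕ → ℝ → ℝ)
    (hG : ∀ n < r, ∀ c ∈ Set.Icc a b, ∀ d ∈ Set.Icc a b, c < d → G n c = 0 → G n d = 0 →
      ∃ ξ ∈ Set.Ioo c d, G (n + 1) ξ = 0)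
    (x : ℕ → ℝ) (hx : ∀ i ≤ r, x i ∈ Set.Icc a b) (hmono : ∀ i < r, x i ≤ x (i + 1))
    (hzero : ∀ i l, i + l ≤ r → x i = x (i + l) → G l (x i) = 0) :
    ∃ ξ ∈ Set.Icc (x 0) (x r), G r ξ = 0 ∧ (x 0 < x r → ξ ∈ Set.Ioo (x 0) (x r)) := by
  induction r generalizing G x with
  | zero => exact ⟨x 0, by simp, hzero 0 0 le_rfl rfl, fun h => absurd h (lt_irrefl _)⟩
  | succ r ih =>
    have hy : ∀ i, ∃ y, i ≤ r → x i ≤ y ∧ y ≤ x (i + 1) ∧ G 1 y = 0 ∧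
        (x i < x (i + 1) → x i < y ∧ y < x (i + 1)) := by
      intro i
      by_cases hi : i ≤ r
      · rcases (hmono i (by omega)).eq_or_lt with h | h
        · exact ⟨x i, fun _ => ⟨le_rfl, h.le, hzero i 1 (by omega) h,
            fun h' => absurd h' (by simp [h])⟩⟩
        · obtain ⟨ξ, hξ, h0⟩ := hG 0 (by omega) (x i) (hx i (by omega)) (x (i + 1))
            (hx _ (by omega)) h (hzero i 0 (by omega) rfl) (hzero (i + 1) 0 (by omega) rfl)
          exact ⟨ξ, fun _ => ⟨hξ.1.le, hξ.2.le, h0, fun _ => ⟨hξ.1, hξ.2⟩⟩⟩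
      · exact ⟨0, fun h => absurd h hi⟩
    choose y hy using hy
    have hle : ∀ i l, i + l ≤ r + 1 → x i ≤ x (i + l) := by
      intro i l
      induction l with
      | zero => simp
      | succ l ihl => exact fun h => (ihl (by omega)).trans (hmono (i + l) (by omega))
    have hcollapse : ∀ i l, i + (l + 1) ≤ r → y i = y (i + (l + 1)) →
        y i = x i ∧ x i = x (i + (l + 1) + 1) := by
      intro i l hil he
      have h₁ := hy i (by omega)
      have h₂ := hy (i + (l + 1)) hil
      have h₃ : x (i + 1) ≤ x (i + (l + 1)) := by
        simpa [add_assoc, add_comm, add_left_comm] using hle (i + 1) l (by omega)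
      have h₄ := hmono i (by omega)
      have h₅ := hmono (i + (l + 1)) (by omega)
      have h₆ : x i = x (i + 1) := by
        by_contra hc
        have := h₁.2.2.2 (lt_of_le_of_ne h₄ hc)
        linarith [h₂.1]
      have h₇ : x (i + (l + 1)) = x (i + (l + 1) + 1) := by
        by_contra hc
        have := h₂.2.2.2 (lt_of_le_of_ne h₅ hc)
        linarith [h₁.2.1]
      constructor <;> linarith [h₁.1, h₁.2.1, h₂.1, h₂.2.1]
    obtain ⟨ξ, hξ, h0, hlt⟩ := ih (fun n => G (n + 1))
      (fun n hn => hG (n + 1) (by omega)) y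
      (fun i hi => ⟨(hx i (by omega)).1.trans (hy i hi).1,
        (hy i hi).2.1.trans (hx (i + 1) (by omega)).2⟩)
      (fun i hi => (hy i hi.le).2.1.trans (hy (i + 1) hi).1)
      (by
        intro i l hil he
        cases l with
        | zero => exact (hy i hil).2.2.1
        | succ l =>
          obtain ⟨e₁, e₂⟩ := hcollapse i l hil he
          simp only [e₁]
          exact hzero i (l + 1 + 1) (by omega) e₂)
    have hy0 := hy 0 (by omega)
    have hyr := hy r le_rfl
    refine ⟨ξ, ⟨hy0.1.trans hξ.1, hξ.2.trans hyr.2.1⟩, h0, fun hxlt => ?_⟩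
    rcases (hξ.1.trans hξ.2).lt_or_eq with h | h
    · exact ⟨hy0.1.trans_lt (hlt h).1, (hlt h).2.trans_le hyr.2.1⟩
    · cases r with
      | zero =>
        have := hy0.2.2.2 hxlt
        exact ⟨this.1.trans_le hξ.1, hξ.2.trans_lt this.2⟩
      | succ r =>
        have := (hcollapse 0 r (by omega) (by simpa using h)).2
        simp only [zero_add] at this
        exact absurd hxlt (by simp [this])

theorem HasDerivAt.matrix_det {n : ℕ} {A : ℝ → Matrix (Fin n) (Fin n) ℝ}
    {A' : Matrix (Fin n) (Fin n) ℝ} {x : ℝ}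
    (h : ∀ i j, HasDerivAt (fun t => A t i j) (A' i j) x) :
    HasDerivAt (fun t => (A t).det)
      (∑ j, ((A x).updateCol j (fun i => A' i j)).det) x := by
  simp only [Matrix.det_apply']
  rw [Finset.sum_comm]
  refine HasDerivAt.fun_sum fun σ _ => ?_
  rw [← Finset.mul_sum]
  refine HasDerivAt.const_mul _ ?_
  have := HasDerivAt.fun_finsetProd (u := Finset.univ) (f := fun i t => A t (σ i) i)
    (f' := fun i => A' (σ i) i) (x := x) (fun i _ => h _ _)
  refine this.congr_deriv (Finset.sum_congr rfl fun j _ => ?_)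
  rw [← Finset.mul_prod_erase Finset.univ _ (Finset.mem_univ j), smul_eq_mul, mul_comm]
  congr 1
  · simp
  · refine Finset.prod_congr rfl fun i hi => ?_
    rw [Matrix.updateCol_ne (Finset.ne_of_mem_erase hi)]

/-- The leading principal minor of order `N` of an infinite matrix. -/
def leadDet (e : ℕ → ℕ → ℝ) (N : ℕ) : ℝ :=
  Matrix.det (Matrix.of fun i j : Fin N => e i j)

/-- The leading principal minor of order `N` bordered by the row `v` and the column of index `s`. -/
def borderDet (e : ℕ → ℕ → ℝ) (v : ℕ → ℝ) (N s : ℕ) : ℝ :=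
  Matrix.det (Matrix.of fun i j : Fin (N + 1) =>
    (if (i : ℕ) < N then e i else v) (if (j : ℕ) < N then (j : ℕ) else s))

theorem borderDet_self (e : ℕ → ℕ → ℝ) (N : ℕ) :
    borderDet e (e N) N N = leadDet e (N + 1) := by
  unfold borderDet leadDet
  congr 1
  ext i j
  have hi : (if (i : ℕ) < N then e i else e N) = e i := by
    split_ifs with h
    · rfl
    · rw [show (i : ℕ) = N by omega]
  have hj : (if (j : ℕ) < N then (j : ℕ) else N) = j := by
    split_ifs <;> omega
  simp [hi, hj]

/-- Sylvester's determinant identity for a twofold border. -/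
theorem borderDet_sylvester (e : ℕ → ℕ → ℝ) (v : ℕ → ℝ) (N : ℕ) (h : leadDet e N ≠ 0) :
    borderDet e (e N) N N * borderDet e v N (N + 1) -
      borderDet e (e N) N (N + 1) * borderDet e v N N =
      leadDet e N * borderDet e v (N + 1) (N + 1) := by
  let A : Matrix (Fin N) (Fin N) ℝ := Matrix.of fun i j => e i j
  have hA : A.det = leadDet e N := rfl
  have : Invertible A := Matrix.invertibleOfIsUnitDet A (by rw [hA]; exact h.isUnit)
  let S : (ℕ → ℝ) → ℕ → ℝ := fun r s =>
    r s - ((Matrix.of fun (_ : Fin 1) (j : Fin N) => r j) * ⅟A *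
      (Matrix.of fun (i : Fin N) (_ : Fin 1) => e i s)) 0 0
  have hB : ∀ r s, borderDet e r N s = leadDet e N * S r s := by
    intro r s
    unfold borderDet
    rw [← Matrix.det_submatrix_equiv_self (finSumFinEquiv (m := N) (n := 1)),
      ← Matrix.fromBlocks_toBlocks (Matrix.submatrix _ _ _)]
    have h11 : ∀ M : Matrix (Fin N ⊕ Fin 1) (Fin N ⊕ Fin 1) ℝ, M.toBlocks₁₁ = A →
      (Matrix.fromBlocks M.toBlocks₁₁ M.toBlocks₁₂ M.toBlocks₂₁ M.toBlocks₂₂).det = A.det *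
        (M.toBlocks₂₂ - M.toBlocks₂₁ * ⅟A * M.toBlocks₁₂).det := by
      intro M hM
      rw [hM, Matrix.det_fromBlocks₁₁]
    rw [h11 _ (by ext i j; simp [A, Matrix.toBlocks₁₁]), hA]
    congr 1
    rw [Matrix.det_fin_one]
    simp [S, Matrix.toBlocks₁₂, Matrix.toBlocks₂₁, Matrix.toBlocks₂₂, Matrix.mul_apply]
  have hC : borderDet e v (N + 1) (N + 1) =
      leadDet e N * (S (e N) N * S v (N + 1) - S (e N) (N + 1) * S v N) := by
    unfold borderDet
    rw [← Matrix.det_submatrix_equiv_self (finSumFinEquiv (m := N) (n := 2)),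
      ← Matrix.fromBlocks_toBlocks (Matrix.submatrix _ _ _)]
    have h11 : ∀ M : Matrix (Fin N ⊕ Fin 2) (Fin N ⊕ Fin 2) ℝ, M.toBlocks₁₁ = A →
      (Matrix.fromBlocks M.toBlocks₁₁ M.toBlocks₁₂ M.toBlocks₂₁ M.toBlocks₂₂).det = A.det *
        (M.toBlocks₂₂ - M.toBlocks₂₁ * ⅟A * M.toBlocks₁₂).det := by
      intro M hM
      rw [hM, Matrix.det_fromBlocks₁₁]
    rw [h11 _ (by ext i j; simp [A, Matrix.toBlocks₁₁]), hA]
    congr 1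
    rw [Matrix.det_fin_two]
    simp [S, Matrix.toBlocks₁₂, Matrix.toBlocks₂₁, Matrix.toBlocks₂₂, Matrix.mul_apply]
  rw [hB, hB, hB, hB, hC]
  ring

theorem hasDerivAt_borderDet (m N : ℕ) (hN : m ≤ N) (e : ℝ → ℕ → ℕ → ℝ) (v : ℝ → ℕ → ℝ) (x : ℝ)
    (he₀ : ∀ i < N, ∀ c < m, HasDerivAt (fun t => e t i c) 0 x)
    (he : ∀ i < N, ∀ c, m ≤ c → c ≤ N → HasDerivAt (fun t => e t i c) (e x i (c + 1)) x)
    (hv₀ : ∀ c < m, HasDerivAt (fun t => v t c) 0 x)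
    (hv : ∀ c, m ≤ c → c ≤ N → HasDerivAt (fun t => v t c) (v x (c + 1)) x) :
    HasDerivAt (fun t => borderDet (e t) (v t) N N) (borderDet (e x) (v x) N (N + 1)) x := by
  unfold borderDet
  have hcol : ∀ j : Fin (N + 1), (if (j : ℕ) < N then (j : ℕ) else N) = j := by
    intro j
    split_ifs <;> omega
  simp only [hcol]
  refine (HasDerivAt.matrix_det (A' := Matrix.of fun i j : Fin (N + 1) =>
    if (j : ℕ) < m then 0 else (if (i : ℕ) < N then e x i else v x) (j + 1)) ?_).congr_deriv ?_
  · intro i j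
    have := j.2
    simp only [Matrix.of_apply]
    by_cases hi : (i : ℕ) < N <;> by_cases hj : (j : ℕ) < m <;> simp only [hi, hj, if_true, if_false]
    · exact he₀ i hi j hj
    · exact he i hi j (by omega) (by omega)
    · exact hv₀ j hj
    · exact hv j (by omega) (by omega)
  · rw [Finset.sum_eq_single (Fin.last N)]
    · congr 1
      ext i j
      by_cases hj : j = Fin.last N
      · subst hj
        simp [hN]
      · rw [Matrix.updateCol_ne hj]
        have : (j : ℕ) < N := by
          have := Fin.val_ne_iff.mpr hj
          simp at this
          omega
        simp [this]
    · intro j _ hj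
      have hjN : (j : ℕ) < N := by
        have := Fin.val_ne_iff.mpr hj
        simp at this
        omega
      by_cases hjm : (j : ℕ) < m
      · refine Matrix.det_eq_zero_of_column_eq_zero j fun i => ?_
        simp [hjm]
      · let j' : Fin (N + 1) := ⟨j + 1, by omega⟩
        have hne : j' ≠ j := by
          intro h
          have := congrArg Fin.val h
          simp [j'] at this
        refine Matrix.det_zero_of_column_eq hne.symm fun i => ?_
        rw [Matrix.updateCol_self, Matrix.updateCol_ne hne]
        simp [hjm, j']
    · simp

theorem continuousOn_borderDet (N : ℕ) (e : ℝ → ℕ → ℕ → ℝ) (v : ℝ → ℕ → ℝ) (s : Set ℝ)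
    (he : ∀ i < N, ∀ c ≤ N, ContinuousOn (fun t => e t i c) s)
    (hv : ∀ c ≤ N, ContinuousOn (fun t => v t c) s) :
    ContinuousOn (fun t => borderDet (e t) (v t) N N) s := by
  unfold borderDet
  simp only [Matrix.det_apply']
  refine continuousOn_finsetSum _ fun σ _ => continuousOn_const.mul
    (continuousOn_finsetProd _ fun i _ => ?_)
  simp only [Matrix.of_apply]
  have hc : (if (i : ℕ) < N then (i : ℕ) else N) ≤ N := by split_ifs <;> omega
  by_cases hi : ((σ i : Fin (N + 1)) : ℕ) < N
  · simpa only [hi, if_true] using he _ hi _ hc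
  · simpa only [hi, if_false] using hv _ hc

theorem borderDet_sum (e : ℕ → ℕ → ℝ) (c : ℕ → ℝ) (N : ℕ) :
    borderDet e (fun s => ∑ i ∈ Finset.range (N + 1), c i * e i s) N N =
      c N * leadDet e (N + 1) := by
  have h := Matrix.det_updateRow_sum (Matrix.of fun i j : Fin (N + 1) => e i j) (Fin.last N)
    (fun i => c i)
  rw [smul_eq_mul, Fin.val_last] at h
  unfold borderDet leadDet
  rw [← h]
  congr 1
  ext i j
  have hj : (if (j : ℕ) < N then (j : ℕ) else N) = j := by
    split_ifs <;> omega
  rw [Matrix.of_apply, hj]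
  by_cases hi : i = Fin.last N
  · subst hi
    simp [Finset.sum_range]
  · rw [Matrix.updateRow_ne hi]
    have : (i : ℕ) < N := by
      have := Fin.val_ne_iff.mpr hi
      simp at this
      omega
    simp [this]

theorem borderDet_eq_zero (e : ℕ → ℕ → ℝ) (v : ℕ → ℝ) (N : ℕ) (hv : ∀ c ≤ N, v c = 0) :
    borderDet e v N N = 0 := by
  refine Matrix.det_eq_zero_of_row_eq_zero (Fin.last N) fun j => ?_
  have hj : (if (j : ℕ) < N then (j : ℕ) else N) ≤ N := by split_ifs <;> omega
  simpa using hv _ hj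

/-- Rolle's theorem for consecutive bordered Wronskians. -/
theorem exists_borderDet_succ_eq_zero (m N : ℕ) (hN : m ≤ N) (e : ℝ → ℕ → ℕ → ℝ)
    (v : ℝ → ℕ → ℝ) {a b : ℝ} (hab : a < b)
    (hec : ∀ i ≤ N, ∀ c ≤ N, ContinuousOn (fun t => e t i c) (Set.Icc a b))
    (hvc : ∀ c ≤ N, ContinuousOn (fun t => v t c) (Set.Icc a b))
    (he₀ : ∀ i ≤ N, ∀ c < m, ∀ x ∈ Set.Ioo a b, HasDerivAt (fun t => e t i c) 0 x)
    (he : ∀ i ≤ N, ∀ c, m ≤ c → c ≤ N → ∀ x ∈ Set.Ioo a b,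
      HasDerivAt (fun t => e t i c) (e x i (c + 1)) x)
    (hv₀ : ∀ c < m, ∀ x ∈ Set.Ioo a b, HasDerivAt (fun t => v t c) 0 x)
    (hv : ∀ c, m ≤ c → c ≤ N → ∀ x ∈ Set.Ioo a b, HasDerivAt (fun t => v t c) (v x (c + 1)) x)
    (hV : ∀ x ∈ Set.Icc a b, leadDet (e x) N ≠ 0)
    (hV' : ∀ x ∈ Set.Icc a b, leadDet (e x) (N + 1) ≠ 0)
    (ha : borderDet (e a) (v a) N N = 0) (hb : borderDet (e b) (v b) N N = 0) :
    ∃ ξ ∈ Set.Ioo a b, borderDet (e ξ) (v ξ) (N + 1) (N + 1) = 0 := by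
  simp only [← borderDet_self] at hV'
  obtain ⟨ξ, hξ, h0⟩ := exists_hasDerivAt_eq_zero hab
    (f := fun t => borderDet (e t) (v t) N N / borderDet (e t) (e t N) N N)
    ((continuousOn_borderDet N e v _ (fun i hi => hec i hi.le) hvc).div
      (continuousOn_borderDet N e (fun t => e t N) _ (fun i hi => hec i hi.le) (hec N le_rfl)) hV')
    (by simp [ha, hb])
    (fun x hx => (hasDerivAt_borderDet m N hN e v x (fun i hi c hc => he₀ i hi.le c hc x hx)
      (fun i hi c h₁ h₂ => he i hi.le c h₁ h₂ x hx) (fun c hc => hv₀ c hc x hx)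
      (fun c h₁ h₂ => hv c h₁ h₂ x hx)).fun_div
      (hasDerivAt_borderDet m N hN e (fun t => e t N) x (fun i hi c hc => he₀ i hi.le c hc x hx)
      (fun i hi c h₁ h₂ => he i hi.le c h₁ h₂ x hx) (fun c hc => he₀ N le_rfl c hc x hx)
      (fun c h₁ h₂ => he N le_rfl c h₁ h₂ x hx)) (hV' x (Set.Ioo_subset_Icc_self hx)))
  have hξ' := Set.Ioo_subset_Icc_self hξ
  refine ⟨ξ, hξ, ?_⟩
  have hs := borderDet_sylvester (e ξ) (v ξ) N (hV ξ hξ')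
  rw [div_eq_zero_iff, or_iff_left (pow_ne_zero 2 (hV' ξ hξ'))] at h0
  have : leadDet (e ξ) N * borderDet (e ξ) (v ξ) (N + 1) (N + 1) = 0 := by
    rw [← hs]
    linarith
  exact (mul_eq_zero.mp this).resolve_left (hV ξ hξ')

/-- A nontrivial combination of the rows of `e` which vanishes in the first `m` columns and has
`k + 1` zeros, counted with multiplicity, forces a zero of the determinant of order `m + k + 1`. -/
theorem exists_leadDet_eq_zero (m k : ℕ) (a b : ℝ) (e : ℝ → ℕ → ℕ → ℝ)
    (hconst : ∀ i ≤ m + k, ∀ c < m, ∀ s t, e s i c = e t i c)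
    (hcont : ∀ i ≤ m + k, ∀ c < m + k, ContinuousOn (fun t => e t i c) (Set.Icc a b))
    (hderiv : ∀ i ≤ m + k, ∀ c, m ≤ c → c < m + k → ∀ t ∈ Set.Ioo a b,
      HasDerivAt (fun t => e t i c) (e t i (c + 1)) t)
    (hV : ∀ n ≤ k, ∀ t ∈ Set.Icc a b, leadDet (e t) (m + n) ≠ 0)
    (y : ℕ → ℝ) (hy : ∀ i ≤ k, y i ∈ Set.Icc a b) (hmono : ∀ i < k, y i ≤ y (i + 1))
    (hlt : y 0 < y k) (c : ℕ → ℝ) (hc : ∃ i ≤ m + k, c i ≠ 0)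
    (hc₀ : ∀ j < m, ∀ t, ∑ i ∈ Finset.range (m + k + 1), c i * e t i j = 0)
    (hc₁ : ∀ i l, i + l ≤ k → y i = y (i + l) →
      ∑ r ∈ Finset.range (m + k + 1), c r * e (y i) r (m + l) = 0) :
    ∃ ξ ∈ Set.Ioo (y 0) (y k), leadDet (e ξ) (m + k + 1) = 0 := by
  classical
  obtain ⟨i₀, hi₀, hci₀⟩ := hc
  set N := Nat.findGreatest (fun i => c i ≠ 0) (m + k)
  have hN : c N ≠ 0 := Nat.findGreatest_spec (P := fun i => c i ≠ 0) hi₀ hci₀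
  have hNle : N ≤ m + k := Nat.findGreatest_le _
  have hNgt : ∀ i, N < i → i ≤ m + k → c i = 0 := fun i h₁ h₂ => by
    simpa using Nat.findGreatest_is_greatest h₁ h₂
  have htrunc : ∀ t j, ∀ M, N < M → M ≤ m + k + 1 →
      ∑ i ∈ Finset.range (m + k + 1), c i * e t i j = ∑ i ∈ Finset.range M, c i * e t i j := by
    intro t j M hM hM'
    refine (Finset.sum_subset (Finset.range_mono hM') fun i hi hi' => ?_).symm
    rw [Finset.mem_range] at hi hi'
    rw [hNgt i (by omega) (by omega), zero_mul]
  have hmle : m ≤ N := by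
    by_contra hlt'
    have h := Matrix.eq_zero_of_vecMul_eq_zero (hV 0 (Nat.zero_le k) (y 0) (hy 0 (Nat.zero_le k)))
      (v := fun i : Fin (m + 0) => c i) (by
        ext j
        have := hc₀ j j.2 (y 0)
        rw [htrunc _ _ m (by omega) (by omega), Finset.sum_range] at this
        simpa [Matrix.vecMul, dotProduct] using this)
    exact hN (congrFun h ⟨N, by omega⟩)
  obtain ⟨n, hn⟩ := Nat.exists_eq_add_of_le hmle
  have hnk : n ≤ k := by omega
  let φ : ℝ → ℕ → ℝ := fun t j => ∑ i ∈ Finset.range (m + k + 1), c i * e t i j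
  obtain ⟨ξ, hξ, h0, hξlt⟩ := exists_zero_of_rolle_chain a b n
    (fun l t => borderDet (e t) (φ t) (m + l) (m + l))
    (by
      intro l hl s hs t ht hst h₁ h₂
      have hsub : Set.Icc s t ⊆ Set.Icc a b := Set.Icc_subset_Icc hs.1 ht.2
      have hsub' : Set.Ioo s t ⊆ Set.Ioo a b := Set.Ioo_subset_Ioo hs.1 ht.2
      refine exists_borderDet_succ_eq_zero m (m + l) (by omega) e φ hst ?_ ?_ ?_ ?_ ?_ ?_
        (fun x hx => hV l (by omega) x (hsub hx)) (fun x hx => hV (l + 1) (by omega) x (hsub hx))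
        h₁ h₂
      · exact fun i hi j hj => (hcont i (by omega) j (by omega)).mono hsub
      · exact fun j hj => continuousOn_finsetSum _ fun i hi => continuousOn_const.mul
          ((hcont i (by rw [Finset.mem_range] at hi; omega) j (by omega)).mono hsub)
      · intro i hi j hj x _
        simp only [hconst i (by omega) j hj _ x]
        exact hasDerivAt_const _ _
      · exact fun i hi j h₃ h₄ x hx => hderiv i (by omega) j h₃ (by omega) x (hsub' hx)
      · intro j hj x _
        simp only [φ, hc₀ j hj]
        exact hasDerivAt_const _ _
      · exact fun j h₃ h₄ x hx => HasDerivAt.fun_sum fun i hi => (hderiv i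
          (by rw [Finset.mem_range] at hi; omega) j h₃ (by omega) x (hsub' hx)).const_mul _)
    y (fun i hi => hy i (by omega)) (fun i hi => hmono i (by omega))
    (by
      intro i l hil heq
      refine borderDet_eq_zero _ _ _ fun j hj => ?_
      rcases lt_or_ge j m with h | h
      · exact hc₀ j h _
      · obtain ⟨l', rfl⟩ := Nat.exists_eq_add_of_le h
        have hmono' : ∀ r s, r ≤ s → s ≤ k → y r ≤ y s := by
          intro r s hrs
          induction s, hrs using Nat.le_induction with
          | base => exact fun _ => le_rfl
          | succ s _ ihs => exact fun hs => (ihs (by omega)).trans (hmono s (by omega))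
        refine hc₁ i l' (by omega) (le_antisymm (hmono' _ _ (by omega) (by omega)) ?_)
        rw [heq]
        exact hmono' _ _ (by omega) (by omega))
  have hlead : leadDet (e ξ) (N + 1) = 0 := by
    have hφ : φ ξ = fun j => ∑ i ∈ Finset.range (N + 1), c i * e ξ i j :=
      funext fun j => htrunc ξ j (N + 1) (by omega) (by omega)
    rw [hφ, ← hn, borderDet_sum] at h0
    exact (mul_eq_zero.mp h0).resolve_left hN
  rcases hnk.lt_or_eq with h | h
  · refine absurd hlead ?_
    rw [hn]
    exact hV (n + 1) h ξ ⟨(hy 0 (by omega)).1.trans hξ.1, hξ.2.trans (hy n hnk).2⟩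
  · subst h
    exact ⟨ξ, hξlt hlt, hn ▸ hlead⟩

theorem multBefore_eq_card {n : ℕ} (x : Fin n → ℝ) (j : Fin n) :
    multBefore x j = (Finset.univ.filter fun i => i < j ∧ x i = x j).card := by
  rw [multBefore, Nat.card_eq_fintype_card, Fintype.card_subtype]

theorem multBefore_const {n : ℕ} (ξ : ℝ) (j : Fin n) : multBefore (fun _ => ξ) j = j := by
  have h : (Finset.univ.filter fun i : Fin n => i < j ∧ ξ = ξ) = Finset.Iio j := by
    ext i
    simp
  rw [multBefore_eq_card, h, Fin.card_Iio]

theorem exists_multBefore_eq {n : ℕ} (x : Fin n → ℝ) (z : ℝ) (l : ℕ)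
    (hl : l < (Finset.univ.filter fun i => x i = z).card) :
    ∃ j, x j = z ∧ multBefore x j = l := by
  have hlt : ∀ j j', x j = z → x j' = z → j < j' → multBefore x j < multBefore x j' := by
    intro j j' hj hj' h
    rw [multBefore_eq_card, multBefore_eq_card]
    refine Finset.card_lt_card (Finset.ssubset_iff_of_subset ?_ |>.mpr ⟨j, ?_, ?_⟩)
    · intro i hi
      simp only [Finset.mem_filter, Finset.mem_univ, true_and] at hi ⊢
      exact ⟨hi.1.trans h, by rw [hi.2, hj, hj']⟩
    · simp [h, hj, hj']
    · simp
  have himage : (Finset.univ.filter fun i => x i = z).image (multBefore x) =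
      Finset.range (Finset.univ.filter fun i => x i = z).card := by
    refine Finset.eq_of_subset_of_card_le ?_ ?_
    · intro r hr
      obtain ⟨j, hj, rfl⟩ := Finset.mem_image.mp hr
      simp only [Finset.mem_filter, Finset.mem_univ, true_and] at hj
      rw [Finset.mem_range, multBefore_eq_card]
      refine Finset.card_lt_card (Finset.ssubset_iff_of_subset ?_ |>.mpr ⟨j, ?_, ?_⟩)
      · intro i hi
        simp only [Finset.mem_filter, Finset.mem_univ, true_and] at hi ⊢
        rw [hi.2, hj]
      · simp [hj]
      · simp
    · rw [Finset.card_range, Finset.card_image_of_injOn]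
      intro j hj j' hj' h
      simp only [Finset.coe_filter, Finset.mem_univ, true_and, Set.mem_ofPred_eq] at hj hj'
      rcases lt_trichotomy j j' with h' | h' | h'
      · exact absurd h (hlt j j' hj hj' h').ne
      · exact h'
      · exact absurd h (hlt j' j hj' hj h').ne'
  obtain ⟨j, hj, rfl⟩ := Finset.mem_image.mp (himage ▸ Finset.mem_range.mpr hl)
  exact ⟨j, by simpa using hj, rfl⟩

/-- The row of `genWu` belonging to the vector `p` and the function `f`. -/
noncomputable def genRow (m : ℕ) {k : ℕ} (x : Fin k → ℝ) (p : Fin m → ℝ) (f : ℝ → ℝ) :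
    Fin (m + k) → ℝ :=
  fun j => Fin.addCases (fun jm : Fin m => p jm)
    (fun jk : Fin k => iteratedDeriv (multBefore x jk) f (x jk)) j

/-- The infinite row formed by `p` followed by all derivatives of `f` at `t`. -/
noncomputable def jetRow (m : ℕ) (p : Fin m → ℝ) (f : ℝ → ℝ) (t : ℝ) (c : ℕ) : ℝ :=
  if h : c < m then p ⟨c, h⟩ else iteratedDeriv (c - m) f t

theorem jetRow_add (m : ℕ) (p : Fin m → ℝ) (f : ℝ → ℝ) (t : ℝ) (l : ℕ) :
    jetRow m p f t (m + l) = iteratedDeriv l f t := by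
  simp [jetRow]

theorem genRow_castAdd (m : ℕ) {k : ℕ} (x : Fin k → ℝ) (p : Fin m → ℝ) (f : ℝ → ℝ) (t : ℝ)
    (j : Fin m) : genRow m x p f (Fin.castAdd k j) = jetRow m p f t j := by
  simp [genRow, jetRow]

theorem genRow_natAdd (m : ℕ) {k : ℕ} (x : Fin k → ℝ) (p : Fin m → ℝ) (f : ℝ → ℝ) (j : Fin k) :
    genRow m x p f (Fin.natAdd m j) = jetRow m p f (x j) (m + multBefore x j) := by
  simp [genRow, jetRow]

theorem genRow_const (m : ℕ) {k : ℕ} (ξ : ℝ) (p : Fin m → ℝ) (f : ℝ → ℝ) (j : Fin (m + k)) :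
    genRow m (fun _ : Fin k => ξ) p f j = jetRow m p f ξ j := by
  refine Fin.addCases (fun i => ?_) (fun i => ?_) j
  · exact genRow_castAdd m _ p f ξ i
  · rw [genRow_natAdd, multBefore_const, Fin.val_natAdd]

theorem genWu_snoc (m k : ℕ) (w : Fin (m + k) → ℝ → ℝ) (u : Fin (m + k) → Fin m → ℝ)
    (f : ℝ → ℝ) (p : Fin m → ℝ) (x : Fin (k + 1) → ℝ) :
    genWu m (k + 1) (Fin.snoc w f) (Fin.snoc u p) x =
      Matrix.det (Matrix.of (Fin.snoc (α := fun _ => Fin (m + k + 1) → ℝ)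
        (fun i => genRow m x (u i) (w i)) (genRow m x p f))) := by
  unfold genWu
  congr 1
  ext i j
  rw [Matrix.of_apply, Matrix.of_apply]
  refine Fin.lastCases (n := m + k) ?_ (fun i => ?_) i
  · simp only [Fin.snoc_last]
    exact congrArg₂ (fun p f => genRow m x p f j) (Fin.snoc_last (α := fun _ => Fin m → ℝ) ..)
      (Fin.snoc_last (α := fun _ => ℝ → ℝ) ..)
  · simp only [Fin.snoc_castSucc]
    rfl

theorem det_snoc_sub {n : ℕ} (A : Fin n → Fin (n + 1) → ℝ) (r s : Fin (n + 1) → ℝ) (α β : ℝ) :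
    Matrix.det (Matrix.of (Fin.snoc (α := fun _ => Fin (n + 1) → ℝ) A (α • r - β • s))) =
      α * Matrix.det (Matrix.of (Fin.snoc (α := fun _ => Fin (n + 1) → ℝ) A r)) -
      β * Matrix.det (Matrix.of (Fin.snoc (α := fun _ => Fin (n + 1) → ℝ) A s)) := by
  have h : ∀ v, Matrix.of (Fin.snoc (α := fun _ => Fin (n + 1) → ℝ) A v) =
      (Matrix.of (Fin.snoc (α := fun _ => Fin (n + 1) → ℝ) A 0)).updateRow (Fin.last n) v := by
    intro v
    ext i j
    refine Fin.lastCases ?_ (fun i => ?_) i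
    · simp
    · rw [Matrix.updateRow_ne (Fin.castSucc_lt_last i).ne]
      simp
  rw [h, h r, h s, sub_eq_add_neg, ← neg_smul, Matrix.det_updateRow_add,
    Matrix.det_updateRow_smul, Matrix.det_updateRow_smul]
  ring

theorem MemDk.continuousOn_jetRow {k : ℕ} (hk : 1 ≤ k) {a b : ℝ} {f : ℝ → ℝ} (hf : MemDk k a b f)
    (m : ℕ) (p : Fin m → ℝ) {c : ℕ} (hc : c < m + k) :
    ContinuousOn (fun t => jetRow m p f t c) (Set.Icc a b) := by
  unfold jetRow
  by_cases h : c < m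
  · simpa only [h, dite_true] using continuousOn_const
  · simpa only [h, dite_false] using hf.2.1 (c - m) (by omega)

theorem MemDk.hasDerivAt_jetRow {k : ℕ} (hk : 1 ≤ k) {a b : ℝ} {f : ℝ → ℝ} (hf : MemDk k a b f)
    (m : ℕ) (p : Fin m → ℝ) {c : ℕ} (hmc : m ≤ c) (hc : c < m + k) {t : ℝ}
    (ht : t ∈ Set.Ioo a b) :
    HasDerivAt (fun t => jetRow m p f t c) (jetRow m p f t (c + 1)) t := by
  obtain ⟨l, rfl⟩ := Nat.exists_eq_add_of_le hmc
  rw [add_assoc]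
  simp only [jetRow_add]
  rw [iteratedDeriv_succ]
  refine DifferentiableAt.hasDerivAt (f := iteratedDeriv l f) ?_
  rcases Nat.lt_or_ge l (k - 1) with h | h
  · exact hf.1 l h t (Set.Ioo_subset_Icc_self ht)
  · rw [show l = k - 1 by omega]
    exact hf.2.2 t ht

/-- **A general mean value theorem** (Theorem 1).  -/
theorem general_mean_value_theorem (k m : ℕ) (hk : 1 ≤ k) (a b : ℝ) (hab : a < b)
    (u : Fin (m + k) → Fin m → ℝ)
    (hu : 0 < m → Matrix.det (Matrix.of fun i j : Fin m => u (Fin.castAdd k i) j) ≠ 0)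
    (w : Fin (m + k) → ℝ → ℝ) (hw : ∀ i, MemDk k a b (w i))
    (hV : ∀ n, 1 ≤ n → ∀ hn : n ≤ k, ∀ ξ ∈ Set.Icc a b,
      genWu m n (fun i => w (Fin.castLE (by omega) i))
        (fun i => u (Fin.castLE (by omega) i)) (fun _ => ξ) ≠ 0)
    (x : Fin (k + 1) → ℝ) (hx : ∀ i, x i ∈ Set.Icc a b) (hne : ¬ ∀ i j, x i = x j)
    (p q : Fin m → ℝ) (f g : ℝ → ℝ) (hf : MemDk k a b f) (hg : MemDk k a b g) :
    ∃ ξ ∈ Set.Ioo (Finset.univ.inf' Finset.univ_nonempty x)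
        (Finset.univ.sup' Finset.univ_nonempty x),
      genWu m (k + 1) (Fin.snoc w f) (Fin.snoc u p) (fun _ => ξ) *
          genWu m (k + 1) (Fin.snoc w g) (Fin.snoc u q) x =
        genWu m (k + 1) (Fin.snoc w g) (Fin.snoc u q) (fun _ => ξ) *
          genWu m (k + 1) (Fin.snoc w f) (Fin.snoc u p) x := by
  simp only [genWu_snoc m k]
  set A : (Fin (k + 1) → ℝ) → Fin (m + k) → Fin (m + k + 1) → ℝ :=
    fun z i => genRow m z (u i) (w i) with hA
  set α := Matrix.det (Matrix.of (Fin.snoc (α := fun _ => Fin (m + k + 1) → ℝ) (A x)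
    (genRow m x q g)))
  set β := Matrix.det (Matrix.of (Fin.snoc (α := fun _ => Fin (m + k + 1) → ℝ) (A x)
    (genRow m x p f)))
  let e : ℝ → ℕ → ℕ → ℝ := fun t i c => if h : i < m + k then jetRow m (u ⟨i, h⟩) (w ⟨i, h⟩) t c
    else α * jetRow m p f t c - β * jetRow m q g t c
  have he : ∀ t (i : Fin (m + k)) c, e t i c = jetRow m (u i) (w i) t c := by
    intro t i c
    simp [e]
  have he' : ∀ t c, e t (m + k) c = α * jetRow m p f t c - β * jetRow m q g t c := by
    intro t c
    simp [e]
  -- the sorted points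
  set σ := Tuple.sort x
  have hσ : Monotone (x ∘ σ) := Tuple.monotone_sort x
  let y : ℕ → ℝ := fun i => if h : i < k + 1 then x (σ ⟨i, h⟩) else 0
  have hy : ∀ i (h : i < k + 1), y i = x (σ ⟨i, h⟩) := fun i h => dif_pos h
  have hymono : ∀ i j, i ≤ j → j < k + 1 → y i ≤ y j := by
    intro i j hij hj
    rw [hy i (by omega), hy j hj]
    exact hσ (by simpa using hij)
  have hlt : y 0 < y k := by
    refine lt_of_le_of_ne (hymono 0 k (by omega) (by omega)) fun h => hne ?_
    have : ∀ i, x i = y 0 := by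
      intro i
      obtain ⟨j, rfl⟩ := σ.surjective i
      rw [← hy j j.2]
      exact le_antisymm (h ▸ hymono j k (by omega) (by omega)) (hymono 0 j (by omega) j.2)
    intro i j
    rw [this i, this j]
  -- a linear dependence between the rows at `x`
  have hdet : Matrix.det (Matrix.of (Fin.snoc (α := fun _ => Fin (m + k + 1) → ℝ) (A x)
      (α • genRow m x p f - β • genRow m x q g))) = 0 := by
    rw [det_snoc_sub]
    ring
  obtain ⟨c, hc, hcM⟩ := Matrix.exists_vecMul_eq_zero_iff.mpr hdet
  let C : ℕ → ℝ := fun i => if h : i < m + k + 1 then c ⟨i, h⟩ else 0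
  have hC : ∀ i : Fin (m + k + 1), C i = c i := fun i => dif_pos i.2
  have hsum : ∀ (t : ℝ) (s : ℕ) (j : Fin (m + k + 1)),
      (∀ p' f', genRow m x p' f' j = jetRow m p' f' t s) →
      ∑ i ∈ Finset.range (m + k + 1), C i * e t i s = 0 := by
    intro t s j hj
    have h := congrFun hcM j
    rw [Finset.sum_range]
    simp only [Matrix.vecMul, dotProduct, Pi.zero_apply, Matrix.of_apply] at h
    rw [← h]
    refine Finset.sum_congr rfl fun i _ => ?_
    rw [hC]
    congr 1
    refine Fin.lastCases ?_ (fun i => ?_) i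
    · rw [Fin.val_last, he']
      simp [hj]
    · rw [Fin.val_castSucc, he]
      simp [hA, hj]
  obtain ⟨ξ, hξ, h0⟩ := exists_leadDet_eq_zero m k a b e
    (by
      intro i _ s hs t t'
      simp only [e, jetRow, hs, dite_true])
    (by
      intro i hi s hs
      rcases hi.lt_or_eq with h | rfl
      · simpa only [e, h, dite_true] using (hw ⟨i, h⟩).continuousOn_jetRow hk m _ hs
      · simp only [he']
        exact (continuousOn_const.mul (hf.continuousOn_jetRow hk m _ hs)).sub
          (continuousOn_const.mul (hg.continuousOn_jetRow hk m _ hs)))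
    (by
      intro i hi s hms hs t ht
      rcases hi.lt_or_eq with h | rfl
      · simpa only [e, h, dite_true] using (hw ⟨i, h⟩).hasDerivAt_jetRow hk m _ hms hs ht
      · simp only [he']
        exact ((hf.hasDerivAt_jetRow hk m _ hms hs ht).const_mul _).fun_sub
          ((hg.hasDerivAt_jetRow hk m _ hms hs ht).const_mul _))
    (by
      intro n hn t ht
      rcases Nat.eq_zero_or_pos n with rfl | hpos
      · rcases Nat.eq_zero_or_pos m with rfl | hm
        · simp [leadDet]
        · have h : leadDet (e t) m =
              Matrix.det (Matrix.of fun i j : Fin m => u (Fin.castAdd k i) j) := by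
            unfold leadDet
            congr 1
            ext i j
            simpa [jetRow] using he t (Fin.castAdd k i) j
          rw [Nat.add_zero, h]
          exact hu hm
      · convert hV n hpos hn t ht using 1
        unfold leadDet
        congr 1
        ext i j
        exact (he t (Fin.castLE (by omega) i) j).trans (genRow_const m t _ _ j).symm)
    y (fun i hi => by rw [hy i (by omega)]; exact hx _)
    (fun i hi => hymono i (i + 1) (by omega) (by omega)) hlt C
    (by
      obtain ⟨i, hi⟩ := Function.ne_iff.mp hc
      exact ⟨i, by omega, by simpa [hC] using hi⟩)
    (fun j hj t => hsum t j (Fin.castAdd (k + 1) ⟨j, hj⟩) fun p' f' =>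
      genRow_castAdd m x p' f' t ⟨j, hj⟩)
    (by
      intro i l hil heq
      have hcard : l < (Finset.univ.filter fun r => x r = y i).card := by
        have := Finset.card_le_card_of_injOn (s := (Finset.univ : Finset (Fin (l + 1))))
          (t := Finset.univ.filter fun r => x r = y i)
          (fun r => σ ⟨i + r, by omega⟩)
          (by
            intro r _
            simp only [Finset.coe_filter, Finset.mem_univ, true_and, Set.mem_ofPred_eq]
            rw [← hy]
            exact le_antisymm (heq ▸ hymono _ _ (by omega) (by omega))
              (hymono _ _ (by omega) (by omega)))
          (by
            intro r _ s _ hrs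
            have := σ.injective hrs
            simp only [Fin.mk.injEq] at this
            omega)
        simpa using this
      obtain ⟨j, hj, rfl⟩ := exists_multBefore_eq x (y i) l hcard
      refine hsum _ _ (Fin.natAdd m j) fun p' f' => ?_
      rw [← hj]
      exact genRow_natAdd m x p' f' j)
  refine ⟨ξ, ⟨lt_of_le_of_lt ?_ hξ.1, lt_of_lt_of_le hξ.2 ?_⟩, ?_⟩
  · rw [hy 0 (by omega)]
    exact Finset.inf'_le _ (Finset.mem_univ _)
  · rw [hy k (by omega)]
    exact Finset.le_sup' _ (Finset.mem_univ _)
  · have hlead : Matrix.det (Matrix.of (Fin.snoc (α := fun _ => Fin (m + k + 1) → ℝ)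
        (A fun _ => ξ) (α • genRow m (fun _ : Fin (k + 1) => ξ) p f -
          β • genRow m (fun _ : Fin (k + 1) => ξ) q g))) =
        leadDet (e ξ) (m + k + 1) := by
      unfold leadDet
      congr 1
      ext i j
      refine Fin.lastCases ?_ (fun i => ?_) i
      · have h₁ := genRow_const m ξ p f (k := k + 1) j
        have h₂ := genRow_const m ξ q g (k := k + 1) j
        simp [he', h₁, h₂]
      · have h₁ := genRow_const m ξ (u i) (w i) (k := k + 1) j
        simp [hA, he, h₁]
    rw [det_snoc_sub, h0] at hlead
    linarith
end

section
/- Let f, g ∈ D^k([a,b]) with g^{(k)}(ξ) ≠ 0 for every ξ ∈ ]a,b[, and let a ≤ x_1 ≤ ⋯ ≤ x_{k+1} ≤ b with x_1 < x_{k+1}. Then [x_1,…,x_{k+1}]g ≠ 0 and there exists ξ ∈ ]x_1, x_{k+1}[ such that [x_1,…,x_{k+1}]f / [x_1,…,x_{k+1}]g = f^{(k)}(ξ) / g^{(k)}(ξ). -/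
/-- The `k`-th order divided difference of `f` over the points `x 0, …, x k`,
defined as a ratio of generalized Wronskian determinants for the system
`1, t, …, t^(k-1)` (cf. Schumaker). -/
noncomputable def divDiff (k : ℕ) (f : ℝ → ℝ) (x : Fin (k + 1) → ℝ) : ℝ :=
  genW (Fin.snoc (fun i : Fin k => fun t : ℝ => t ^ (i : ℕ)) f) x /
    genW (fun i : Fin (k + 1) => fun t : ℝ => t ^ (i : ℕ)) x

open Polynomial in
theorem iteratedDeriv_polynomial_eval (p : ℝ[X]) (n : ℕ) :
    iteratedDeriv n (fun t => p.eval t) = fun t => (derivative^[n] p).eval t := by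
  induction n with
  | zero => simp
  | succ n ih =>
    rw [iteratedDeriv_succ, ih]
    funext t
    rw [Polynomial.deriv, Function.iterate_succ_apply']

/-- `F 0, F 1, …, F k` is a chain of successive derivatives on `]a,b[`, all of whose members
before the last are continuous on `[a,b]`. -/
structure IsDerivChain (k : ℕ) (a b : ℝ) (F : ℕ → ℝ → ℝ) : Prop where
  continuousOn : ∀ j < k, ContinuousOn (F j) (Set.Icc a b)
  hasDerivAt : ∀ j < k, ∀ t ∈ Set.Ioo a b, HasDerivAt (F j) (F (j + 1) t) t

/-- Consecutive equal points of a monotone sequence `x 0 ≤ ⋯ ≤ x k` are zeros of the successive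
members of the chain `F`. -/
def VanishesAlong (k : ℕ) (x : ℕ → ℝ) (F : ℕ → ℝ → ℝ) : Prop :=
  ∀ i j, i ≤ j → j ≤ k → x i = x j → F (j - i) (x j) = 0

theorem MemDk.isDerivChain {k : ℕ} {a b : ℝ} {f : ℝ → ℝ} (hf : MemDk k a b f) :
    IsDerivChain k a b (fun j => iteratedDeriv j f) where
  continuousOn j hj := hf.2.1 j (by omega)
  hasDerivAt j hj t ht := by
    have h : DifferentiableAt ℝ (iteratedDeriv j f) t := by
      rcases (show j < k - 1 ∨ j = k - 1 by omega) with h | rfl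
      · exact hf.1 j h t (Set.Ioo_subset_Icc_self ht)
      · exact hf.2.2 t ht
    simpa only [iteratedDeriv_succ] using h.hasDerivAt

open Polynomial in
theorem isDerivChain_polynomial (k : ℕ) (a b : ℝ) (p : ℝ[X]) :
    IsDerivChain k a b (fun j t => (derivative^[j] p).eval t) where
  continuousOn j _ := (derivative^[j] p).continuous.continuousOn
  hasDerivAt j _ t _ := by
    simpa only [Function.iterate_succ_apply'] using (derivative^[j] p).hasDerivAt t

namespace IsDerivChain

variable {k : ℕ} {a b : ℝ} {F G : ℕ → ℝ → ℝ}

theorem add (hF : IsDerivChain k a b F) (hG : IsDerivChain k a b G) :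
    IsDerivChain k a b (fun j t => F j t + G j t) where
  continuousOn j hj := (hF.continuousOn j hj).add (hG.continuousOn j hj)
  hasDerivAt j hj t ht := (hF.hasDerivAt j hj t ht).add (hG.hasDerivAt j hj t ht)

theorem const_mul (c : ℝ) (hF : IsDerivChain k a b F) :
    IsDerivChain k a b (fun j t => c * F j t) where
  continuousOn j hj := (hF.continuousOn j hj).const_mul c
  hasDerivAt j hj t ht := (hF.hasDerivAt j hj t ht).const_mul c

theorem shift (hF : IsDerivChain (k + 1) a b F) :
    IsDerivChain k a b (fun j => F (j + 1)) where
  continuousOn j hj := hF.continuousOn (j + 1) (by omega)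
  hasDerivAt j hj := hF.hasDerivAt (j + 1) (by omega)

/-- Generalized Rolle theorem, counting zeros with multiplicities. -/
theorem exists_eq_zero (hF : IsDerivChain (k + 1) a b F) {x : ℕ → ℝ} (hx : Monotone x)
    (ha : a ≤ x 0) (hb : x (k + 1) ≤ b) (hlt : x 0 < x (k + 1))
    (hv : VanishesAlong (k + 1) x F) :
    ∃ ξ ∈ Set.Ioo (x 0) (x (k + 1)), F (k + 1) ξ = 0 := by
  induction k generalizing F x with
  | zero =>
    refine exists_hasDerivAt_eq_zero hlt
      ((hF.continuousOn 0 (by omega)).mono (Set.Icc_subset_Icc ha hb)) ?_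
      fun t ht => hF.hasDerivAt 0 (by omega) t (Set.Ioo_subset_Ioo ha hb ht)
    rw [hv 0 0 le_rfl (by omega) rfl, hv 1 1 le_rfl le_rfl rfl]
  | succ k ih =>
    have hy : ∀ i, ∃ y, x i ≤ y ∧ y ≤ x (i + 1) ∧
        (i ≤ k + 1 → x i = x (i + 1) ∨ (x i < y ∧ y < x (i + 1) ∧ F 1 y = 0)) := by
      intro i
      by_cases hi : i ≤ k + 1
      · rcases (hx i.le_succ).eq_or_lt with h | h
        · exact ⟨x i, le_rfl, h.le, fun _ => Or.inl h⟩
        · have hai : a ≤ x i := ha.trans (hx i.zero_le)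
          have hbi : x (i + 1) ≤ b := (hx (by omega)).trans hb
          obtain ⟨y, hy, hy0⟩ := exists_hasDerivAt_eq_zero h
            ((hF.continuousOn 0 (by omega)).mono (Set.Icc_subset_Icc hai hbi))
            (by
              have h₁ := hv i i le_rfl (by omega) rfl
              have h₂ := hv (i + 1) (i + 1) le_rfl (by omega) rfl
              rw [Nat.sub_self] at h₁ h₂
              rw [h₁, h₂])
            fun t ht => hF.hasDerivAt 0 (by omega) t (Set.Ioo_subset_Ioo hai hbi ht)
          exact ⟨y, hy.1.le, hy.2.le, fun _ => Or.inr ⟨hy.1, hy.2, hy0⟩⟩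
      · exact ⟨x i, le_rfl, hx i.le_succ, fun h => absurd h hi⟩
    choose y hxy hyx hy using hy
    have hmono : Monotone y := monotone_nat_of_le_succ fun i => (hyx i).trans (hxy (i + 1))
    have key : ∀ i j, i < j → j ≤ k + 1 → y i = y j → x i = x (j + 1) ∧ y j = x (j + 1) := by
      intro i j hij hj h
      have h₁ := hx (show i + 1 ≤ j from hij)
      have h₂ := hyx i
      have h₃ := hxy j
      have h₄ := hyx j
      rcases hy i (by omega) with hi | hi
      · rcases hy j hj with hj | hj
        · constructor <;> linarith
        · linarith [hj.1]
      · linarith [hi.2.1]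
    have hlt' : y 0 < y (k + 1) := by
      refine (hmono (Nat.zero_le _)).lt_of_ne fun h => ?_
      exact hlt.ne (key 0 (k + 1) (by omega) le_rfl h).1
    obtain ⟨ξ, hξ, h0⟩ := ih hF.shift hmono (ha.trans (hxy 0)) ((hyx _).trans hb) hlt' (by
      intro i j hij hj h
      rcases hij.eq_or_lt with rfl | hij
      · simp only [Nat.sub_self, Nat.zero_add]
        rcases hy i hj with hi | hi
        · have h₁ := hv i (i + 1) i.le_succ (by omega) hi
          have h₂ : y i = x (i + 1) := le_antisymm (hyx i) (hi ▸ hxy i)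
          rwa [Nat.add_sub_cancel_left, ← h₂] at h₁
        · exact hi.2.2
      · obtain ⟨h₁, h₂⟩ := key i j hij hj h
        have h₃ := hv i (j + 1) (by omega) (by omega) h₁
        simpa only [h₂, show j - i + 1 = j + 1 - i by omega] using h₃)
    exact ⟨ξ, ⟨(hxy 0).trans_lt hξ.1, hξ.2.trans_le (hyx _)⟩, h0⟩

end IsDerivChain

open Polynomial in
/-- A polynomial of degree at most `k` with `k + 1` zeros, counted with multiplicities,
vanishes identically. -/
theorem Polynomial.eq_zero_of_vanishesAlong {k : ℕ} {p : ℝ[X]} (hp : p.natDegree ≤ k)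
    {x : ℕ → ℝ} (hx : Monotone x)
    (hv : VanishesAlong k x (fun j t => (derivative^[j] p).eval t)) : p = 0 := by
  by_contra h0
  have hle : (Multiset.range (k + 1)).map x ≤ p.roots := by
    rw [Multiset.le_iff_count]
    intro c
    rw [count_roots, Multiset.count_map]
    change (((Finset.range (k + 1)).filter fun i => c = x i).card) ≤ _
    set S := (Finset.range (k + 1)).filter fun i => c = x i with hS
    rcases S.eq_empty_or_nonempty with h | h
    · simp [h]
    · have hmin := S.min'_mem h
      have hmax := S.max'_mem h
      set i := S.min' h
      set j := S.max' h
      have hsub : S ⊆ Finset.Icc i j := fun l hl =>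
        Finset.mem_Icc.2 ⟨S.min'_le l hl, S.le_max' l hl⟩
      have hcard := Finset.card_le_card hsub
      rw [Nat.card_Icc] at hcard
      have hij : i ≤ j := S.min'_le j hmax
      simp only [hS, Finset.mem_filter, Finset.mem_range] at hmin hmax
      have : j - i < p.rootMultiplicity c := by
        rw [lt_rootMultiplicity_iff_isRoot_iterate_derivative h0]
        intro m hm
        have hxm : x (i + m) = c := le_antisymm
          ((hx (by omega : i + m ≤ j)).trans hmax.2.ge) (hmin.2.le.trans (hx (by omega)))
        have := hv i (i + m) (by omega) (by omega) (by rw [hxm, hmin.2])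
        simpa only [IsRoot.def, hxm, Nat.add_sub_cancel_left] using this
      omega
  have := (Multiset.card_le_card hle).trans p.card_roots'
  rw [Multiset.card_map, Multiset.card_range] at this
  omega

/-- For a monotone family, the derivative order of a column is its distance to the first index
carrying the same point. -/
theorem multBefore_eq_sub {k : ℕ} {x : Fin k → ℝ} (hx : Monotone x) {i j : Fin k}
    (hxij : x i = x j) (hfirst : ∀ l, x l = x j → i ≤ l) :
    multBefore x j = (j : ℕ) - i := by
  have h : ∀ l, (l < j ∧ x l = x j) ↔ l ∈ Finset.Ico i j := by
    intro l
    rw [Finset.mem_Ico]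
    constructor
    · exact fun h => ⟨hfirst l h.2, h.1⟩
    · exact fun h => ⟨h.2, le_antisymm (hx h.2.le) (hxij ▸ hx h.1)⟩
  rw [multBefore, Nat.card_congr (Equiv.subtypeEquivRight h), Nat.card_eq_fintype_card,
    Fintype.card_coe, Fin.card_Ico]

theorem vanishesAlong_of_multBefore {k : ℕ} {x : Fin (k + 1) → ℝ} (hx : Monotone x)
    {F : ℕ → ℝ → ℝ} (h : ∀ j, F (multBefore x j) (x j) = 0) :
    VanishesAlong k (fun i => x ⟨min i k, by omega⟩) F := by
  intro i j hij hj hxij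
  set j' : Fin (k + 1) := ⟨min j k, by omega⟩ with hj'
  set i' : Fin (k + 1) := ⟨min i k, by omega⟩
  have hxij' : x i' = x j' := hxij
  set S := Finset.univ.filter fun l => x l = x j' with hS
  have hne : S.Nonempty := ⟨j', by simp [hS]⟩
  have hmem : x (S.min' hne) = x j' := by simpa [hS] using S.min'_mem hne
  have hmin : ∀ l, x l = x j' → S.min' hne ≤ l := fun l hl => S.min'_le l (by simp [hS, hl])
  set m := S.min' hne
  have hmi : (m : ℕ) ≤ i := by
    have : (m : ℕ) ≤ min i k := hmin i' hxij'
    omega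
  let l : Fin (k + 1) := ⟨m + (j - i), by omega⟩
  have hml : m ≤ l := Fin.le_def.2 (by simp [l])
  have hlj : l ≤ j' := Fin.le_def.2 (by simp only [l, hj']; omega)
  have hxl : x l = x j' := le_antisymm (hx hlj) (hmem ▸ hx hml)
  have := h l
  rw [multBefore_eq_sub hx (hmem.trans hxl.symm) (fun n hn => hmin n (hn.trans hxl)), hxl]
    at this
  simpa [l] using this

/-- The matrix of derivatives of the monomials `1, t, …, t^k` at the points `x`. -/
noncomputable def monomialMatrix {k : ℕ} (x : Fin (k + 1) → ℝ) :
    Matrix (Fin (k + 1)) (Fin (k + 1)) ℝ :=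
  Matrix.of fun i j => iteratedDeriv (multBefore x j) (fun t : ℝ => t ^ (i : ℕ)) (x j)

/-- The generalized Wronskian of `1, t, …, t^(k-1)` and a chain `F` of derivatives. -/
noncomputable def chainDet {k : ℕ} (x : Fin (k + 1) → ℝ) (F : ℕ → ℝ → ℝ) : ℝ :=
  ((monomialMatrix x).updateRow (Fin.last k) fun j => F (multBefore x j) (x j)).det

theorem chainDet_add {k : ℕ} (x : Fin (k + 1) → ℝ) (F G : ℕ → ℝ → ℝ) :
    chainDet x (fun j t => F j t + G j t) = chainDet x F + chainDet x G :=
  Matrix.det_updateRow_add _ _ _ _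

theorem chainDet_const_mul {k : ℕ} (x : Fin (k + 1) → ℝ) (c : ℝ) (F : ℕ → ℝ → ℝ) :
    chainDet x (fun j t => c * F j t) = c * chainDet x F :=
  Matrix.det_updateRow_smul _ _ _ _

theorem genW_snoc_eq_chainDet {k : ℕ} (x : Fin (k + 1) → ℝ) (f : ℝ → ℝ) :
    genW (Fin.snoc (fun i : Fin k => fun t : ℝ => t ^ (i : ℕ)) f) x =
      chainDet x (fun j => iteratedDeriv j f) := by
  unfold genW chainDet
  congr 1
  ext i j
  refine Fin.lastCases ?_ (fun i => ?_) i
  · simp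
  · simp [monomialMatrix]

theorem genW_monomials_eq_chainDet {k : ℕ} (x : Fin (k + 1) → ℝ) :
    genW (fun i : Fin (k + 1) => fun t : ℝ => t ^ (i : ℕ)) x =
      chainDet x (fun j => iteratedDeriv j fun t => t ^ k) := by
  rw [← genW_snoc_eq_chainDet]
  congr 1
  funext i
  refine Fin.lastCases ?_ (fun i => ?_) i <;> simp

open Polynomial in
theorem IsDerivChain.exists_eq_zero_of_chainDet_eq_zero {k : ℕ} (hk : 1 ≤ k) {a b : ℝ}
    {F : ℕ → ℝ → ℝ} (hF : IsDerivChain k a b F) {x : Fin (k + 1) → ℝ} (hx : Monotone x)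
    (ha : a ≤ x 0) (hb : x (Fin.last k) ≤ b) (hlt : x 0 < x (Fin.last k))
    (hdet : chainDet x F = 0) :
    ∃ ξ ∈ Set.Ioo (x 0) (x (Fin.last k)), F k ξ = 0 := by
  obtain ⟨v, hv0, hv⟩ := Matrix.exists_vecMul_eq_zero_iff.2 hdet
  set p : ℝ[X] := ∑ i : Fin k, C (v i.castSucc) * X ^ (i : ℕ) with hp
  have hpdeg : p.degree < k := by
    refine (degree_sum_le _ _).trans_lt ((Finset.sup_lt_iff (WithBot.bot_lt_coe k)).2 ?_)
    intro i _
    exact (degree_C_mul_X_pow_le _ _).trans_lt (Nat.cast_lt.2 i.2)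
  set G : ℕ → ℝ → ℝ := fun j t => v (Fin.last k) * F j t + (derivative^[j] p).eval t with hG
  have hGchain : IsDerivChain k a b G :=
    (hF.const_mul _).add (isDerivChain_polynomial k a b p)
  have hGv : ∀ j, G (multBefore x j) (x j) = 0 := by
    intro j
    have h := congrFun hv j
    simp only [Matrix.vecMul, dotProduct, Fin.sum_univ_castSucc, Matrix.updateRow_self,
      Matrix.updateRow_ne (Fin.castSucc_lt_last _).ne, Pi.zero_apply] at h
    refine Eq.trans (add_comm _ _) (Eq.trans ?_ h)
    simp only [hp, iterate_derivative_sum, eval_finsetSum, iterate_derivative_C_mul, eval_mul,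
      eval_C]
    congr 1
    refine Finset.sum_congr rfl fun i _ => ?_
    have := congrFun (iteratedDeriv_polynomial_eval (X ^ (i : ℕ)) (multBefore x j)) (x j)
    simp only [eval_pow, eval_X] at this
    rw [monomialMatrix, Matrix.of_apply, Fin.val_castSucc, this]
  have hX : Monotone fun i : ℕ => x ⟨min i k, by omega⟩ := fun i j hij =>
    hx (Fin.le_def.2 (min_le_min_right k hij))
  have hvan := vanishesAlong_of_multBefore hx hGv
  obtain ⟨n, rfl⟩ : ∃ n, k = n + 1 := ⟨k - 1, by omega⟩
  have hX0 : x ⟨min 0 (n + 1), by omega⟩ = x 0 := congrArg x (Fin.ext (by simp))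
  have hXl : x ⟨min (n + 1) (n + 1), by omega⟩ = x (Fin.last (n + 1)) :=
    congrArg x (Fin.ext (by simp))
  obtain ⟨ξ, hξ, h0⟩ := hGchain.exists_eq_zero hX (ha.trans_eq hX0.symm) (hXl.trans_le hb)
    (by rwa [hX0, hXl]) hvan
  rw [hX0, hXl] at hξ
  refine ⟨ξ, hξ, ?_⟩
  simp only [hG, iterate_derivative_eq_zero_of_degree_lt hpdeg, eval_zero, add_zero] at h0
  refine (mul_eq_zero.1 h0).resolve_left fun hlast => hv0 ?_
  have hp0 : p = 0 := by
    refine eq_zero_of_vanishesAlong (natDegree_le_of_degree_le hpdeg.le) hX ?_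
    simpa only [hG, hlast, zero_mul, zero_add] using hvan
  funext i
  refine Fin.lastCases hlast (fun i => ?_) i
  have := congrArg (fun q => q.coeff (i : ℕ)) hp0
  simpa [hp, finsetSum_coeff, coeff_X_pow, Fin.val_inj] using this

/-- **Cauchy mean value theorem for divided differences** (Corollary 4, Rätz–Russel). -/
theorem divDiff_cauchy_mean_value (k : ℕ) (hk : 1 ≤ k) (a b : ℝ) (f g : ℝ → ℝ)
    (hf : MemDk k a b f) (hg : MemDk k a b g)
    (hg' : ∀ ξ ∈ Set.Ioo a b, iteratedDeriv k g ξ ≠ 0)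
    (x : Fin (k + 1) → ℝ) (hmono : Monotone x)
    (ha : a ≤ x 0) (hb : x (Fin.last k) ≤ b) (hlt : x 0 < x (Fin.last k)) :
    divDiff k g x ≠ 0 ∧
      ∃ ξ ∈ Set.Ioo (x 0) (x (Fin.last k)),
        divDiff k f x / divDiff k g x = iteratedDeriv k f ξ / iteratedDeriv k g ξ := by
  have hV : genW (fun i : Fin (k + 1) => fun t : ℝ => t ^ (i : ℕ)) x ≠ 0 := by
    rw [genW_monomials_eq_chainDet]
    intro h
    have hpow := fun j => iteratedDeriv_polynomial_eval (Polynomial.X ^ k) j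
    simp only [Polynomial.eval_pow, Polynomial.eval_X] at hpow
    simp only [hpow] at h
    obtain ⟨ξ, _, hξ⟩ := (isDerivChain_polynomial k a b
      (Polynomial.X ^ k)).exists_eq_zero_of_chainDet_eq_zero hk hmono ha hb hlt h
    rw [Polynomial.iterate_derivative_X_pow_eq_smul] at hξ
    simp [Nat.descFactorial_self, Nat.factorial_ne_zero] at hξ
  have hgdet : chainDet x (fun j => iteratedDeriv j g) ≠ 0 := by
    intro h
    obtain ⟨ξ, hξ, h0⟩ :=
      hg.isDerivChain.exists_eq_zero_of_chainDet_eq_zero hk hmono ha hb hlt h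
    exact hg' ξ (Set.Ioo_subset_Ioo ha hb hξ) h0
  simp only [divDiff, genW_snoc_eq_chainDet]
  refine ⟨div_ne_zero hgdet hV, ?_⟩
  set Nf := chainDet x (fun j => iteratedDeriv j f)
  set Ng := chainDet x (fun j => iteratedDeriv j g)
  obtain ⟨ξ, hξ, h0⟩ := ((hf.isDerivChain.const_mul Ng).add
    (hg.isDerivChain.const_mul (-Nf))).exists_eq_zero_of_chainDet_eq_zero hk hmono ha hb hlt
    (by rw [chainDet_add, chainDet_const_mul, chainDet_const_mul]; ring)
  refine ⟨ξ, hξ, ?_⟩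
  rw [div_div_div_cancel_right₀ hV, div_eq_div_iff hgdet
    (hg' ξ (Set.Ioo_subset_Ioo ha hb hξ))]
  linarith
end

section
/- If f ∈ D^k([a,b]) vanishes k+1 times in [a,b], then its derivative f' vanishes k times in [a,b]. -/
/-- To show that `f` vanishes `K` times it suffices to give distinct points indexed by any finite
type, some possibly of multiplicity zero, with a point of positive multiplicity in `]a,b[`. -/
theorem VanishesTimes.of_injective {ι : Type*} [Fintype ι] {K : ℕ} {a b : ℝ} {f : ℝ → ℝ}
    (y : ι → ℝ) (μ : ι → ℕ) (hy : Function.Injective y) (hmem : ∀ i, y i ∈ Set.Icc a b)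
    (p : ι) (hp : 1 ≤ μ p) (hpab : y p ∈ Set.Ioo a b) (hsum : ∑ i, μ i = K)
    (hzero : ∀ i, ∀ j < μ i, iteratedDeriv j f (y i) = 0) :
    VanishesTimes K a b f := by
  classical
  let T := {i : ι // 1 ≤ μ i}
  let _ : LinearOrder T :=
    LinearOrder.lift' (fun t : T => y t.1) (hy.comp Subtype.val_injective)
  obtain ⟨n, hn⟩ : ∃ n, Fintype.card T = n + 1 :=
    Nat.exists_eq_succ_of_ne_zero (Fintype.card_pos_iff.mpr ⟨⟨p, hp⟩⟩).ne'
  let e : Fin (n + 1) ≃o T := monoEquivOfFin T hn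
  have hmono : StrictMono fun i => y (e i).1 := fun i j hij => e.strictMono hij
  have hpe : y (e (e.symm ⟨p, hp⟩)).1 = y p := by rw [OrderIso.apply_symm_apply]
  refine ⟨n, fun i => y (e i).1, fun i => μ (e i).1, hmono, fun i => hmem _, ?_, ?_,
    fun i => (e i).2, ?_, fun i j hj => hzero _ j hj⟩
  · exact ((hmono.monotone (Fin.zero_le (e.symm ⟨p, hp⟩))).trans_eq hpe).trans_lt hpab.2
  · exact hpab.1.trans_le (hpe.symm.trans_le (hmono.monotone (Fin.le_last (e.symm ⟨p, hp⟩))))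
  · refine (Equiv.sum_comp e.toEquiv fun t : T => μ t.1).trans ?_
    rw [← hsum, ← Finset.sum_subtype (Finset.univ.filter (1 ≤ μ ·)) (by simp) μ]
    exact Finset.sum_filter_of_ne fun i _ hi => Nat.one_le_iff_ne_zero.mpr hi

/-- If each `ξ i` lies strictly between the consecutive terms `x i` and `x (i + 1)`, then all
these points are distinct. -/
theorem injective_sumElim_of_interlacing {n : ℕ} {x : Fin (n + 1) → ℝ} {ξ : Fin n → ℝ}
    (hx : StrictMono x) (hξ : ∀ i, ξ i ∈ Set.Ioo (x i.castSucc) (x i.succ)) :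
    Function.Injective (Sum.elim x ξ) := by
  have hmono : StrictMono ξ := fun i j hij =>
    (hξ i).2.trans_le ((hx.monotone (Fin.succ_le_castSucc_iff.mpr hij)).trans (hξ j).1.le)
  refine hx.injective.sumElim hmono.injective fun i j hij => ?_
  have h := hξ j
  rw [← hij] at h
  have h₁ := hx.lt_iff_lt.mp h.1
  have h₂ := hx.lt_iff_lt.mp h.2
  simp only [Fin.lt_def, Fin.val_castSucc, Fin.val_succ] at h₁ h₂
  omega

/-- **Lemma 2**: if `f` vanishes `k+1` times in `[a,b]`, then `f'` vanishes `k` times. -/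
theorem vanishes_deriv (k : ℕ) (hk : 1 ≤ k) (a b : ℝ) (f : ℝ → ℝ)
    (hf : MemDk k a b f) (hvan : VanishesTimes (k + 1) a b f) :
    VanishesTimes k a b (deriv f) := by
  obtain ⟨n, x, κ, hx, hmem, hxb, hxa, hκ, hsum, hzero⟩ := hvan
  have hcont : ContinuousOn f (Set.Icc a b) := by simpa using hf.2.1 0 (Nat.zero_le _)
  have hfx : ∀ i, f (x i) = 0 := fun i => by simpa using hzero i 0 (hκ i)
  choose ξ hξ hξ0 using fun i : Fin n =>
    exists_deriv_eq_zero (hx i.castSucc_lt_succ)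
      (hcont.mono (Set.Icc_subset_Icc (hmem i.castSucc).1 (hmem i.succ).2))
      ((hfx i.castSucc).trans (hfx i.succ).symm)
  have hξab : ∀ i, ξ i ∈ Set.Ioo a b := fun i =>
    ⟨(hmem i.castSucc).1.trans_lt (hξ i).1, (hξ i).2.trans_le (hmem i.succ).2⟩
  obtain ⟨p, hp, hpab⟩ : ∃ p : Fin (n + 1) ⊕ Fin n,
      1 ≤ Sum.elim (fun i => κ i - 1) (fun _ => 1) p ∧ Sum.elim x ξ p ∈ Set.Ioo a b := by
    cases n with
    | zero =>
      have hκ0 : κ 0 = k + 1 := by simpa using hsum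
      exact ⟨Sum.inl 0, by simp [hκ0, hk], hxa, hxb⟩
    | succ m => exact ⟨Sum.inr 0, le_rfl, hξab 0⟩
  refine VanishesTimes.of_injective (Sum.elim x ξ) (Sum.elim (fun i => κ i - 1) fun _ => 1)
    (injective_sumElim_of_interlacing hx hξ) ?_ p hp hpab ?_ ?_
  · rintro (i | i)
    exacts [hmem i, Set.Ioo_subset_Icc_self (hξab i)]
  · have hsplit : ∑ i, κ i = ∑ i, (κ i - 1) + (n + 1) := by
      rw [← Finset.sum_congr rfl fun i _ => Nat.sub_add_cancel (hκ i), Finset.sum_add_distrib]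
      simp
    simp only [Fintype.sum_sum_type, Sum.elim_inl, Sum.elim_inr, Finset.sum_const,
      Finset.card_univ, Fintype.card_fin, smul_eq_mul, mul_one]
    omega
  · rintro (i | i) j hj
    · simp only [Sum.elim_inl] at hj ⊢
      rw [← iteratedDeriv_succ']
      exact hzero i (j + 1) (by omega)
    · obtain rfl : j = 0 := by simpa using hj
      simpa using hξ0 i
end

section
/- Let 1 ≤ k and 1 ≤ m be integers and u_1, …, u_{m+k} ∈ ℝ^m with u_1, …, u_m linearly independent, and let w_1, …, w_{m+k} ∈ D^k([a,b]) satisfy V_n(ξ) := W(w_1,…,w_{m+n}; u_1,…,u_{m+n})(ξ,…,ξ) ≠ 0 for all ξ ∈ [a,b] and n = 1, …, k. For n = 1, …, k, let γ_{1,n}, …, γ_{m,n} be the unique reals with −u_{m+n} = γ_{1,n}u_1 + ⋯ + γ_{m,n}u_m and set v_n := w_{m+n} + γ_{1,n}w_1 + ⋯ + γ_{m,n}w_m. Then the functions v_1, …, v_k are linearly independent over ℝ. -/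
theorem multBefore_lt {k : ℕ} (x : Fin k → ℝ) (j : Fin k) : multBefore x j < k := by
  have h := Finite.card_subtype_lt (p := fun i : Fin k => i < j ∧ x i = x j) (x := j) (by simp)
  simpa [multBefore] using h

/-- A linear relation between functions of class `D^k` on `]a,b[` is inherited by their
derivatives of order less than `k`. -/
theorem sum_mul_iteratedDeriv_eq_zero {ι : Type*} [Fintype ι] {k : ℕ} {a b : ℝ}
    {w : ι → ℝ → ℝ} (hw : ∀ i, MemDk k a b (w i)) {d : ι → ℝ}
    (hd : ∀ t ∈ Set.Ioo a b, ∑ i, d i * w i t = 0) {j : ℕ} (hj : j < k) :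
    ∀ t ∈ Set.Ioo a b, ∑ i, d i * iteratedDeriv j (w i) t = 0 := by
  induction j with
  | zero => simpa using hd
  | succ j ih =>
    intro t ht
    have hderiv : HasDerivAt (fun s => ∑ i, d i * iteratedDeriv j (w i) s)
        (∑ i, d i * iteratedDeriv (j + 1) (w i) t) t := by
      refine HasDerivAt.fun_sum fun i _ => HasDerivAt.const_mul (d i) ?_
      rw [iteratedDeriv_succ]
      exact ((hw i).1 j (by omega) t (Set.Ioo_subset_Icc_self ht)).hasDerivAt
    have hzero : (fun s => ∑ i, d i * iteratedDeriv j (w i) s) =ᶠ[nhds t] fun _ => 0 := by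
      filter_upwards [isOpen_Ioo.mem_nhds ht] with s hs using ih (by omega) s hs
    exact hderiv.unique ((hasDerivAt_const t (0 : ℝ)).congr_of_eventuallyEq hzero)

/-- The functions `v₁, …, v_k` are linearly independent (as functions on `[a,b]`). -/
theorem v_linearIndependent (k m : ℕ) (hk : 1 ≤ k) (hm : 1 ≤ m) (a b : ℝ) (hab : a < b)
    (u : Fin (m + k) → Fin m → ℝ)
    (hu : LinearIndependent ℝ (fun i : Fin m => u (Fin.castAdd k i)))
    (w : Fin (m + k) → ℝ → ℝ) (hw : ∀ i, MemDk k a b (w i))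
    (hV : ∀ n, 1 ≤ n → ∀ hn : n ≤ k, ∀ ξ ∈ Set.Icc a b,
      genWu m n (fun i => w (Fin.castLE (by omega) i))
        (fun i => u (Fin.castLE (by omega) i)) (fun _ => ξ) ≠ 0)
    (γ : Fin k → Fin m → ℝ)
    (hγ : ∀ n : Fin k, ∀ j : Fin m,
      -u (Fin.natAdd m n) j = ∑ i : Fin m, γ n i * u (Fin.castAdd k i) j)
    (v : Fin k → ℝ → ℝ)
    (hv : ∀ n : Fin k, ∀ t : ℝ,
      v n t = w (Fin.natAdd m n) t + ∑ i : Fin m, γ n i * w (Fin.castAdd k i) t) :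
    LinearIndependent ℝ (fun n : Fin k => (Set.Icc a b).restrict (v n)) := by
  rw [Fintype.linearIndependent_iff]
  intro c hc n
  have hcv : ∀ t ∈ Set.Icc a b, ∑ n, c n * v n t = 0 := fun t ht => by
    simpa [Set.restrict] using congrFun hc ⟨t, ht⟩
  let d : Fin (m + k) → ℝ := Fin.addCases (fun i => ∑ n, c n * γ n i) c
  have hsum : ∀ f : Fin (m + k) → ℝ, ∑ i, d i * f i =
      ∑ n, c n * (f (Fin.natAdd m n) + ∑ i, γ n i * f (Fin.castAdd k i)) := fun f => by
    simp only [Fin.sum_univ_add, d, Fin.addCases_left, Fin.addCases_right, mul_add,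
      Finset.sum_add_distrib, Finset.sum_mul, Finset.mul_sum, mul_assoc]
    rw [Finset.sum_comm, add_comm]
  have hdw : ∀ t ∈ Set.Ioo a b, ∑ i, d i * w i t = 0 := fun t ht => by
    simpa only [hsum fun i => w i t, ← hv] using hcv t (Set.Ioo_subset_Icc_self ht)
  obtain ⟨ξ, hξ⟩ := Set.nonempty_Ioo.2 hab
  have hd : d = 0 := by
    refine Matrix.eq_zero_of_vecMul_eq_zero (hV k hk le_rfl ξ (Set.Ioo_subset_Icc_self hξ)) ?_
    ext j
    induction j using Fin.addCases with
    | left j =>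
      simp only [Matrix.vecMul, dotProduct, Matrix.of_apply, Fin.addCases_left, Pi.zero_apply]
      refine (hsum fun i => u i j).trans ?_
      simp only [← hγ, add_neg_cancel, mul_zero, Finset.sum_const_zero]
    | right j =>
      simp only [Matrix.vecMul, dotProduct, Matrix.of_apply, Fin.addCases_right, Pi.zero_apply]
      exact sum_mul_iteratedDeriv_eq_zero hw hdw (multBefore_lt _ j) ξ hξ
  simpa [d] using congrFun hd (Fin.natAdd m n)
end

section
/- Let g ∈ D^k([a,b]) with g^{(k)}(ξ) ≠ 0 for every ξ ∈ ]a,b[, and let a ≤ x_1 ≤ ⋯ ≤ x_{k+1} ≤ b with x_1 < x_{k+1}. Then the k-th order divided difference [x_1,…,x_{k+1}]g is nonzero. -/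
/-- Generalized Rolle theorem: if `F 0, F 1, …` are successive derivatives and `F 0` has the
zeros `x 0 ≤ ⋯ ≤ x m`, repetitions counting as multiplicities, then `F m` has a zero. -/
theorem exists_derivative_eq_zero_of_zeros (m : ℕ) (F : ℕ → ℝ → ℝ) (x : ℕ → ℝ)
    (hx : MonotoneOn x (Set.Iic m))
    (hcont : ∀ j < m, ContinuousOn (F j) (Set.Icc (x 0) (x m)))
    (hderiv : ∀ j < m, ∀ t ∈ Set.Ioo (x 0) (x m), HasDerivAt (F j) (F (j + 1) t) t)
    (hzero : ∀ i j, i ≤ j → j ≤ m → x i = x j → F (j - i) (x j) = 0) :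
    ∃ ξ ∈ Set.Icc (x 0) (x m), F m ξ = 0 ∧ (x 0 < x m → ξ ∈ Set.Ioo (x 0) (x m)) := by
  induction m generalizing F x with
  | zero => exact ⟨x 0, by simp, by simpa using hzero 0 0, by simp⟩
  | succ m ih =>
    have hle : ∀ i j, i ≤ j → j ≤ m + 1 → x i ≤ x j := fun i j hij hj =>
      hx (Set.mem_Iic.2 (hij.trans hj)) (Set.mem_Iic.2 hj) hij
    have hex : ∀ i, ∃ y, i ≤ m → F 1 y = 0 ∧ x i ≤ y ∧ y ≤ x (i + 1) ∧
        (x i < x (i + 1) → x i < y ∧ y < x (i + 1)) := by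
      intro i
      by_cases hi : i ≤ m
      swap
      · exact ⟨0, fun h => absurd h hi⟩
      have h0 := hle 0 i (by omega) (by omega)
      have h1 := hle i (i + 1) (by omega) (by omega)
      have h2 := hle (i + 1) (m + 1) (by omega) (by omega)
      rcases h1.eq_or_lt with h | h
      · refine ⟨x (i + 1), fun _ => ⟨?_, h1, le_rfl, fun h' => absurd h h'.ne⟩⟩
        simpa using hzero i (i + 1) (by omega) (by omega) h
      · have e1 : F 0 (x i) = 0 := by simpa using hzero i i le_rfl (by omega) rfl
        have e2 : F 0 (x (i + 1)) = 0 := by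
          simpa using hzero (i + 1) (i + 1) le_rfl (by omega) rfl
        obtain ⟨y, hy, hy0⟩ := exists_hasDerivAt_eq_zero (f := F 0) (f' := F 1) h
          ((hcont 0 (by omega)).mono (Set.Icc_subset_Icc h0 h2)) (e1.trans e2.symm)
          (fun t ht => hderiv 0 (by omega) t (Set.Ioo_subset_Ioo h0 h2 ht))
        exact ⟨y, fun _ => ⟨hy0, hy.1.le, hy.2.le, fun _ => hy⟩⟩
    choose y hy using hex
    have hylt : ∀ i j, i < j → j ≤ m → y i ≤ x (i + 1) ∧ x (i + 1) ≤ x j ∧ x j ≤ y j :=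
      fun i j hij hj => ⟨(hy i (by omega)).2.2.1, hle _ _ (by omega) (by omega), (hy j hj).2.1⟩
    have hy0 := (hy 0 (by omega)).2.1
    have hym := (hy m le_rfl).2.2.1
    obtain ⟨ξ, hξ, hξ0, hξlt⟩ := ih (fun j => F (j + 1)) y
      (by
        intro i _ j hj hij
        rcases hij.eq_or_lt with rfl | h
        · exact le_rfl
        · obtain ⟨h1, h2, h3⟩ := hylt i j h hj
          linarith)
      (fun j hj => (hcont (j + 1) (by omega)).mono (Set.Icc_subset_Icc hy0 hym))
      (fun j hj t ht => hderiv (j + 1) (by omega) t (Set.Ioo_subset_Ioo hy0 hym ht))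
      (by
        intro i j hij hj hyij
        rcases hij.eq_or_lt with rfl | h
        · simpa using (hy i hj).1
        · obtain ⟨h1, h2, h3⟩ := hylt i j h hj
          have hi : x i = x (i + 1) := by
            by_contra hne
            have := (hy i (by omega)).2.2.2
              (lt_of_le_of_ne (hle _ _ (by omega) (by omega)) hne)
            linarith
          have hj' : x j = x (j + 1) := by
            by_contra hne
            have := (hy j (by omega)).2.2.2
              (lt_of_le_of_ne (hle _ _ (by omega) (by omega)) hne)
            linarith
          have := hzero i (j + 1) (by omega) (by omega) (by linarith)
          rw [show y j = x (j + 1) by linarith, show j - i + 1 = j + 1 - i by omega]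
          exact this)
    refine ⟨ξ, ⟨hy0.trans hξ.1, hξ.2.trans hym⟩, hξ0, fun hlt => ?_⟩
    rcases (hξ.1.trans hξ.2).eq_or_lt with heq | h
    · have hξy : ξ = y 0 := le_antisymm (heq ▸ hξ.2) hξ.1
      constructor
      · by_contra hcon
        have h1 := (hy m le_rfl).2.1
        have h2 := hle 0 m (by omega) (by omega)
        have := (hy m le_rfl).2.2.2 (by linarith)
        linarith
      · by_contra hcon
        have h1 := (hy 0 (by omega)).2.2.1
        have h2 := hle (0 + 1) (m + 1) (by omega) (by omega)
        have := (hy 0 (by omega)).2.2.2 (by linarith)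
        linarith
    · exact Set.Ioo_subset_Ioo hy0 hym (hξlt h)

theorem iteratedDeriv_pow_eq_eval (i j : ℕ) (t : ℝ) :
    iteratedDeriv j (fun s : ℝ => s ^ i) t =
      ((Polynomial.derivative^[j] (Polynomial.X ^ i)).eval t : ℝ) := by
  simp [Polynomial.iterate_derivative_X_pow_eq_natCast_mul]

/-- A polynomial with more zeros than its degree, repetitions of a zero counting as vanishing
derivatives, is zero. -/
theorem Polynomial.eq_zero_of_hermite_zeros (k : ℕ) (p : Polynomial ℝ) (hp : p.natDegree ≤ k)
    (x : ℕ → ℝ) (hx : Monotone x)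
    (hzero : ∀ i j, i ≤ j → j ≤ k → x i = x j →
      (Polynomial.derivative^[j - i] p).eval (x j) = 0) : p = 0 := by
  obtain ⟨ξ, -, hξ, -⟩ := exists_derivative_eq_zero_of_zeros p.natDegree
    (fun j t => (Polynomial.derivative^[j] p).eval t) x (hx.monotoneOn _)
    (fun j _ => (Polynomial.continuous _).continuousOn)
    (fun j _ t _ => by
      simpa only [Function.iterate_succ_apply'] using Polynomial.hasDerivAt _ t)
    (fun i j hij hj => hzero i j hij (hj.trans hp))
  have hdeg : (Polynomial.derivative^[p.natDegree] p).natDegree = 0 := by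
    have := Polynomial.natDegree_iterate_derivative p p.natDegree
    omega
  rw [Polynomial.eq_C_of_natDegree_eq_zero hdeg, Polynomial.eval_C,
    Polynomial.coeff_iterate_derivative] at hξ
  simpa [Nat.descFactorial_self, Nat.factorial_ne_zero] using hξ

/-- On a run of equal points of a monotone family every derivative order up to the length of
the run occurs. -/
theorem exists_multBefore_eq_s13 {n : ℕ} (x : Fin n → ℝ) (hx : Monotone x) (i j : Fin n)
    (hij : i ≤ j) (h : x i = x j) :
    ∃ l : Fin n, x l = x j ∧ multBefore x l = (j : ℕ) - i := by
  classical
  obtain ⟨i₀, hi₀, hmin⟩ : ∃ i₀ : Fin n, x i₀ = x j ∧ ∀ l, x l = x j → i₀ ≤ l := by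
    have hne : (Finset.univ.filter fun l => x l = x j).Nonempty := ⟨j, by simp⟩
    exact ⟨_, (Finset.mem_filter.1 (Finset.min'_mem _ hne)).2,
      fun l hl => Finset.min'_le _ _ (by simpa using hl)⟩
  have hi : (i₀ : ℕ) ≤ i := hmin i h
  have hij' : (i : ℕ) ≤ j := hij
  let l : Fin n := ⟨i₀ + (j - i), by omega⟩
  have hl : x l = x j :=
    le_antisymm (hx (Fin.le_def.2 (by simp only [l]; omega)))
      (hi₀ ▸ hx (Fin.le_def.2 (by simp only [l]; omega)))
  refine ⟨l, hl, ?_⟩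
  have hset : ∀ q : Fin n, (q < l ∧ x q = x l) ↔ q ∈ Finset.Ico i₀ l := by
    intro q
    rw [Finset.mem_Ico, hl]
    refine ⟨fun hq => ⟨hmin q hq.2, hq.1⟩, fun hq => ⟨hq.2, ?_⟩⟩
    exact le_antisymm (hl ▸ hx hq.2.le) (hi₀ ▸ hx hq.1)
  unfold multBefore
  rw [Nat.card_congr (Equiv.subtypeEquivRight hset), Nat.card_eq_fintype_card,
    Fintype.card_coe, Fin.card_Ico]
  simp [l]

/-- The generalized Wronskian of `1, t, …, t ^ (k - 1), g` does not vanish when the `k`-th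
derivative of `g` does not. -/
theorem genW_snoc_ne_zero (k : ℕ) (hk : 1 ≤ k) (a b : ℝ) (g : ℝ → ℝ)
    (hg : MemDk k a b g) (hg' : ∀ ξ ∈ Set.Ioo a b, iteratedDeriv k g ξ ≠ 0)
    (x : Fin (k + 1) → ℝ) (hmono : Monotone x)
    (ha : a ≤ x 0) (hb : x (Fin.last k) ≤ b) (hlt : x 0 < x (Fin.last k)) :
    genW (Fin.snoc (fun i : Fin k => fun t : ℝ => t ^ (i : ℕ)) g : Fin (k + 1) → ℝ → ℝ) x
      ≠ 0 := by
  intro hdet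
  obtain ⟨v, hv, hvM⟩ := Matrix.exists_vecMul_eq_zero_iff.2 hdet
  let c := v (Fin.last k)
  let p : Polynomial ℝ := ∑ i : Fin k, Polynomial.C (v i.castSucc) * Polynomial.X ^ (i : ℕ)
  let F : ℕ → ℝ → ℝ := fun j t =>
    (Polynomial.derivative^[j] p).eval t + c * iteratedDeriv j g t
  have hpdeg : p.degree < k := Polynomial.degree_sum_fin_lt fun i : Fin k => v i.castSucc
  have hFcol : ∀ l, F (multBefore x l) (x l) = 0 := by
    intro l
    have h := congrFun hvM l
    simp only [Matrix.vecMul, dotProduct, Matrix.of_apply, Fin.sum_univ_castSucc,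
      Fin.snoc_castSucc, Fin.snoc_last, Pi.zero_apply, iteratedDeriv_pow_eq_eval] at h
    simpa [F, p, c, Polynomial.iterate_derivative_sum, Polynomial.eval_finsetSum,
      Polynomial.iterate_derivative_C_mul] using h
  let y : ℕ → ℝ := fun n => x ⟨min n k, by omega⟩
  have hy : Monotone y := fun i j hij => hmono (Fin.le_def.2 (by simp only; omega))
  have hy0 : y 0 = x 0 := by simp [y]
  have hyk : y k = x (Fin.last k) := congrArg x (Fin.ext (by simp))
  have hzero : ∀ i j, i ≤ j → j ≤ k → y i = y j → F (j - i) (y j) = 0 := by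
    intro i j hij hj hyij
    obtain ⟨l, hl, hm⟩ := exists_multBefore_eq_s13 x hmono ⟨min i k, by omega⟩ ⟨min j k, by omega⟩
      (Fin.le_def.2 (by simp only; omega)) hyij
    have h := hFcol l
    rw [hl, hm] at h
    simpa [y, hj, hij.trans hj] using h
  have hIcc : Set.Icc (y 0) (y k) ⊆ Set.Icc a b :=
    Set.Icc_subset_Icc (hy0 ▸ ha) (hyk ▸ hb)
  have hIoo : Set.Ioo (y 0) (y k) ⊆ Set.Ioo a b :=
    Set.Ioo_subset_Ioo (hy0 ▸ ha) (hyk ▸ hb)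
  obtain ⟨ξ, -, hξ, hξmem⟩ := exists_derivative_eq_zero_of_zeros k F y (hy.monotoneOn _)
    (fun j hj => (Polynomial.continuous _).continuousOn.add
      (((hg.2.1 j (by omega)).mono hIcc).const_smul c))
    (fun j hj t ht => by
      have hd : DifferentiableAt ℝ (iteratedDeriv j g) t := by
        rcases Nat.lt_or_ge j (k - 1) with h | h
        · exact hg.1 j h t (Set.Ioo_subset_Icc_self (hIoo ht))
        · obtain rfl : j = k - 1 := by omega
          exact hg.2.2 t (hIoo ht)
      simp only [F, Function.iterate_succ_apply', iteratedDeriv_succ]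
      exact (Polynomial.hasDerivAt _ t).add (hd.hasDerivAt.const_mul c))
    hzero
  have hc : c = 0 := by
    have h := hg' ξ (hIoo (hξmem (by rwa [hy0, hyk])))
    simpa [F, Polynomial.iterate_derivative_eq_zero_of_degree_lt hpdeg, h] using hξ
  have hp : p = 0 := by
    refine Polynomial.eq_zero_of_hermite_zeros k p
      (Polynomial.natDegree_le_of_degree_le hpdeg.le) y hy fun i j hij hj hyij => ?_
    simpa [F, hc] using hzero i j hij hj hyij
  refine hv (funext fun i => Fin.lastCases hc (fun i => ?_) i)
  have h := congrArg (fun q => Polynomial.coeff q i) hp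
  simpa [p, Polynomial.finsetSum_coeff, Polynomial.coeff_X_pow, Fin.val_inj] using h

theorem memDk_pow (k : ℕ) (a b : ℝ) (n : ℕ) : MemDk k a b fun t => t ^ n := by
  have h : ∀ j, iteratedDeriv j (fun s : ℝ => s ^ n) =
      fun t => (Polynomial.derivative^[j] (Polynomial.X ^ n) : Polynomial ℝ).eval t :=
    fun j => funext (iteratedDeriv_pow_eq_eval n j)
  simp only [MemDk, h]
  exact ⟨fun j _ t _ => Polynomial.differentiableAt _,
    fun j _ => (Polynomial.continuous _).continuousOn,
    fun t _ => Polynomial.differentiableAt _⟩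

/-- The divided difference of a function with nonvanishing `k`-th derivative is nonzero. -/
theorem divDiff_ne_zero (k : ℕ) (hk : 1 ≤ k) (a b : ℝ) (g : ℝ → ℝ)
    (hg : MemDk k a b g) (hg' : ∀ ξ ∈ Set.Ioo a b, iteratedDeriv k g ξ ≠ 0)
    (x : Fin (k + 1) → ℝ) (hmono : Monotone x)
    (ha : a ≤ x 0) (hb : x (Fin.last k) ≤ b) (hlt : x 0 < x (Fin.last k)) :
    divDiff k g x ≠ 0 := by
  have hpow : genW (fun i : Fin (k + 1) => fun t : ℝ => t ^ (i : ℕ)) x ≠ 0 := by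
    convert genW_snoc_ne_zero k hk a b (fun t => t ^ k) (memDk_pow k a b k)
      (fun ξ _ => by simp)
      x hmono ha hb hlt using 2
    refine funext fun i => Fin.lastCases ?_ (fun i => ?_) i <;> simp
  exact div_ne_zero (genW_snoc_ne_zero k hk a b g hg hg' x hmono ha hb hlt) hpow
end
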